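/- Let (S^A, S^B) be a pair of finite orthonormal families of vectors in a finite-dimensional complex inner product space H. If (S^A, S^B) is perfectly distinguishable by post-processing, then the minimum over (a,b) ∈ K_A × K_B of |⟨φ^A_a, φ^B_b⟩|² is at most 1/(|S^A|·|S^B|). -/

import Mathlib

open scoped Classical

notation "⟪" x ", " y "⟫_ℂ" => @inner ℂ _ _ x y

noncomputable section

/-- A POVM over a finite index type `Ω`: a family of positive semidefinite operators
on `H` summing to the identity. -/
def IsPOVM {H : Type*} [NormedAddCommGroup H] [InnerProductSpace ℂ H]
    {Ω : Type*} [Fintype Ω] (M : Ω → H →ₗ[ℂ] H) : Prop :=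
  (∀ ω x, 0 ≤ (⟪x, M ω x⟫_ℂ).re ∧ (⟪x, M ω x⟫_ℂ).im = 0) ∧
    ∑ ω, M ω = LinearMap.id

/-- `(φA, φB)` is perfectly distinguishable by post-processing. -/
def PerfectlyDistinguishable {H : Type*} [NormedAddCommGroup H] [InnerProductSpace ℂ H]
    {KA KB : Type*} [Fintype KA] [Fintype KB] (φA : KA → H) (φB : KB → H) : Prop :=
  ∃ (N : ℕ) (M : Fin N → H →ₗ[ℂ] H) (fA : Fin N → KA) (fB : Fin N → KB),
    IsPOVM M ∧
    (∀ a, ∑ ω ∈ Finset.univ.filter (fun ω => fA ω = a), ⟪φA a, M ω (φA a)⟫_ℂ = 1) ∧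
    (∀ b, ∑ ω ∈ Finset.univ.filter (fun ω => fB ω = b), ⟪φB b, M ω (φB b)⟫_ℂ = 1)

/-- A standard pair in `ℂ^{K_A × K_B}`. -/
def IsStandardPair {KA KB : Type*} [Fintype KA] [Fintype KB]
    (ΦA : KA → EuclideanSpace ℂ (KA × KB)) (ΦB : KB → EuclideanSpace ℂ (KA × KB)) : Prop :=
  ∃ (α β : KA → KB → ℂ),
    (∀ a, ∑ b, ‖α a b‖ ^ 2 = 1) ∧ (∀ b, ∑ a, ‖β a b‖ ^ 2 = 1) ∧
    (∀ a, ΦA a = ∑ b, α a b • EuclideanSpace.single (a, b) (1 : ℂ)) ∧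
    (∀ b, ΦB b = ∑ a, β a b • EuclideanSpace.single (a, b) (1 : ℂ))

/-- Right stochastic matrix: nonnegative entries, rows sum to 1. -/
def RightStochastic {n m : Type*} [Fintype m] (A : Matrix n m ℝ) : Prop :=
  (∀ i j, 0 ≤ A i j) ∧ ∀ i, ∑ j, A i j = 1

/-- Left stochastic matrix: nonnegative entries, columns sum to 1. -/
def LeftStochastic {n m : Type*} [Fintype n] (B : Matrix n m ℝ) : Prop :=
  (∀ i j, 0 ≤ B i j) ∧ ∀ j, ∑ i, B i j = 1

/-- Membership in `D̄(n,m)`: decomposable into an entrywise product of a right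
stochastic matrix and a left stochastic matrix. -/
def MemDBar {n m : Type*} [Fintype n] [Fintype m] (P : Matrix n m ℝ) : Prop :=
  ∃ A B : Matrix n m ℝ, RightStochastic A ∧ LeftStochastic B ∧ ∀ i j, P i j = A i j * B i j

/-- Membership in `D(n,m)`: members of `D̄(n,m)` with all entries strictly positive. -/
def MemD {n m : Type*} [Fintype n] [Fintype m] (P : Matrix n m ℝ) : Prop :=
  MemDBar P ∧ ∀ i j, 0 < P i j

/-- A measurement table for `(φA, φB)`. -/
def IsMeasurementTable {H : Type*} [NormedAddCommGroup H] [InnerProductSpace ℂ H]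
    {KA KB : Type*} [Fintype KA] [Fintype KB]
    (φA : KA → H) (φB : KB → H) (M : KA × KB → H →ₗ[ℂ] H) : Prop :=
  IsPOVM M ∧
    (∀ a, ∑ b, ⟪φA a, M (a, b) (φA a)⟫_ℂ = 1) ∧
    (∀ b, ∑ a, ⟪φB b, M (a, b) (φB b)⟫_ℂ = 1)


/-- The Cauchy–Schwarz inequality for the semi-inner product of a positive operator. -/
theorem LinearMap.IsPositive.norm_inner_sq_le {H : Type*} [NormedAddCommGroup H]
    [InnerProductSpace ℂ H] {T : H →ₗ[ℂ] H} (hT : T.IsPositive) (x y : H) :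
    ‖⟪x, T y⟫_ℂ‖ ^ 2 ≤ (⟪x, T x⟫_ℂ).re * (⟪y, T y⟫_ℂ).re := by
  have hsymm : ∀ u v : H, (starRingEnd ℂ) ⟪v, T u⟫_ℂ = ⟪u, T v⟫_ℂ := fun u v => by
    rw [inner_conj_symm, hT.isSymmetric u v]
  let c : PreInnerProductSpace.Core ℂ H :=
    { inner := fun u v => ⟪u, T v⟫_ℂ
      conj_inner_symm := hsymm
      re_inner_nonneg := hT.re_inner_nonneg_right
      add_left := fun u v w => inner_add_left u v (T w)
      smul_left := fun u v r => inner_smul_left u (T v) r }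
  have key : ‖⟪x, T y⟫_ℂ‖ * ‖⟪y, T x⟫_ℂ‖ ≤ (⟪x, T x⟫_ℂ).re * (⟪y, T y⟫_ℂ).re :=
    InnerProductSpace.Core.inner_mul_inner_self_le (𝕜 := ℂ) (c := c) x y
  rwa [← hsymm y x, RCLike.norm_conj, ← sq] at key

section POVM

variable {H : Type*} [NormedAddCommGroup H] [InnerProductSpace ℂ H]
  {Ω : Type*} [Fintype Ω] {M : Ω → H →ₗ[ℂ] H}

theorem IsPOVM.isPositive (hM : IsPOVM M) (ω : Ω) : (M ω).IsPositive := by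
  rw [LinearMap.isPositive_iff_complex]
  intro x
  obtain ⟨hre, him⟩ := hM.1 ω x
  have hreal : ⟪M ω x, x⟫_ℂ = ⟪x, M ω x⟫_ℂ := by
    rw [← inner_conj_symm, Complex.conj_eq_iff_im.2 him]
  rw [hreal]
  exact ⟨Complex.ext rfl him.symm, hre⟩

theorem IsPOVM.sum_inner (hM : IsPOVM M) (x y : H) : ∑ ω, ⟪x, M ω y⟫_ℂ = ⟪x, y⟫_ℂ := by
  rw [← inner_sum, ← LinearMap.sum_apply, hM.2, LinearMap.id_apply]

/-- An outcome whose label is not `a` has probability zero in the state `φ a`. -/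
theorem IsPOVM.re_inner_eq_zero_of_label_ne {K : Type*} {φ : K → H} {f : Ω → K} (hM : IsPOVM M)
    {a : K} (hφ : ‖φ a‖ = 1)
    (hf : ∑ ω ∈ Finset.univ.filter (fun ω => f ω = a), ⟪φ a, M ω (φ a)⟫_ℂ = 1)
    {ω : Ω} (hω : f ω ≠ a) : (⟪φ a, M ω (φ a)⟫_ℂ).re = 0 := by
  have hsum := hM.sum_inner (φ a) (φ a)
  rw [← Finset.sum_filter_add_sum_filter_not _ (fun ω => f ω = a), hf,
    inner_self_eq_norm_sq_to_K, hφ] at hsum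
  have hzero : ∑ ω ∈ Finset.univ.filter (fun ω => ¬ f ω = a), (⟪φ a, M ω (φ a)⟫_ℂ).re = 0 := by
    rw [← Complex.re_sum]
    simpa using congrArg Complex.re hsum
  exact (Finset.sum_eq_zero_iff_of_nonneg fun ω _ => (hM.1 ω (φ a)).1).1 hzero ω (by simp [hω])

theorem sum_re_inner_label_eq_card {K : Type*} [Fintype K] {φ : K → H} {f : Ω → K}
    (hf : ∀ a, ∑ ω ∈ Finset.univ.filter (fun ω => f ω = a), ⟪φ a, M ω (φ a)⟫_ℂ = 1) :
    ∑ ω, (⟪φ (f ω), M ω (φ (f ω))⟫_ℂ).re = Fintype.card K := by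
  rw [← Finset.sum_fiberwise Finset.univ f]
  have hone : ∀ a, ∑ ω ∈ Finset.univ.filter (fun ω => f ω = a),
      (⟪φ (f ω), M ω (φ (f ω))⟫_ℂ).re = 1 := fun a => by
    rw [Finset.sum_congr rfl fun ω hω => by rw [(Finset.mem_filter.1 hω).2], ← Complex.re_sum,
      hf a, Complex.one_re]
  simp [hone]

end POVM

/-- The overlaps of a perfectly distinguishable pair sum to at most `√(|K_A| |K_B|)`. -/
theorem PerfectlyDistinguishable.sq_sum_norm_inner_le {H : Type*} [NormedAddCommGroup H]
    [InnerProductSpace ℂ H] {KA KB : Type*} [Fintype KA] [Fintype KB] {φA : KA → H} {φB : KB → H}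
    (hA : ∀ a, ‖φA a‖ = 1) (hB : ∀ b, ‖φB b‖ = 1) (hd : PerfectlyDistinguishable φA φB) :
    (∑ a, ∑ b, ‖⟪φA a, φB b⟫_ℂ‖) ^ 2 ≤ (Fintype.card KA : ℝ) * Fintype.card KB := by
  obtain ⟨N, M, fA, fB, hM, hfA, hfB⟩ := hd
  have hvanish : ∀ ω a b, ¬ (fA ω = a ∧ fB ω = b) → ⟪φA a, M ω (φB b)⟫_ℂ = 0 := by
    intro ω a b hne
    have hcs := (hM.isPositive ω).norm_inner_sq_le (φA a) (φB b)
    have hprod : (⟪φA a, M ω (φA a)⟫_ℂ).re * (⟪φB b, M ω (φB b)⟫_ℂ).re = 0 := by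
      rcases not_and_or.1 hne with h | h
      · rw [hM.re_inner_eq_zero_of_label_ne (hA a) (hfA a) h, zero_mul]
      · rw [hM.re_inner_eq_zero_of_label_ne (hB b) (hfB b) h, mul_zero]
    rw [hprod] at hcs
    exact norm_eq_zero.1 (pow_eq_zero_iff two_ne_zero |>.1 (le_antisymm hcs (sq_nonneg _)))
  have hcollapse : ∀ ω, ∑ a, ∑ b, ‖⟪φA a, M ω (φB b)⟫_ℂ‖ = ‖⟪φA (fA ω), M ω (φB (fB ω))⟫_ℂ‖ := by
    intro ω
    rw [Fintype.sum_eq_single (fA ω), Fintype.sum_eq_single (fB ω)]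
    · intro b hb
      rw [hvanish ω _ b fun h => hb h.2.symm, norm_zero]
    · intro a ha
      exact Finset.sum_eq_zero fun b _ => by rw [hvanish ω a b fun h => ha h.1.symm, norm_zero]
  have hle : ∑ a, ∑ b, ‖⟪φA a, φB b⟫_ℂ‖ ≤ ∑ ω, ‖⟪φA (fA ω), M ω (φB (fB ω))⟫_ℂ‖ := by
    calc ∑ a, ∑ b, ‖⟪φA a, φB b⟫_ℂ‖
        ≤ ∑ a, ∑ b, ∑ ω, ‖⟪φA a, M ω (φB b)⟫_ℂ‖ := by
          gcongr with a _ b _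
          rw [← hM.sum_inner]
          exact norm_sum_le _ _
      _ = ∑ ω, ∑ a, ∑ b, ‖⟪φA a, M ω (φB b)⟫_ℂ‖ := by
          rw [Finset.sum_comm (s := (Finset.univ : Finset (Fin N)))]
          exact Finset.sum_congr rfl fun a _ => Finset.sum_comm
      _ = _ := Finset.sum_congr rfl fun ω _ => hcollapse ω
  calc (∑ a, ∑ b, ‖⟪φA a, φB b⟫_ℂ‖) ^ 2
      ≤ (∑ ω, ‖⟪φA (fA ω), M ω (φB (fB ω))⟫_ℂ‖) ^ 2 := by gcongr
    _ ≤ (∑ ω, (⟪φA (fA ω), M ω (φA (fA ω))⟫_ℂ).re) *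
          ∑ ω, (⟪φB (fB ω), M ω (φB (fB ω))⟫_ℂ).re :=
        Finset.sum_sq_le_sum_mul_sum_of_sq_le_mul _ (fun ω _ => (hM.1 ω _).1)
          (fun ω _ => (hM.1 ω _).1) fun ω _ => (hM.isPositive ω).norm_inner_sq_le _ _
    _ = _ := by rw [sum_re_inner_label_eq_card hfA, sum_re_inner_label_eq_card hfB]

/-- Proposition 3: for a perfectly distinguishable pair, the minimal squared overlap is
at most `1 / (|S^A| |S^B|)`. -/
theorem min_overlap_bound_of_distinguishable
    {H : Type*} [NormedAddCommGroup H] [InnerProductSpace ℂ H] [FiniteDimensional ℂ H]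
    {KA KB : Type*} [Fintype KA] [Fintype KB] [Nonempty KA] [Nonempty KB]
    (φA : KA → H) (φB : KB → H) (hA : Orthonormal ℂ φA) (hB : Orthonormal ℂ φB)
    (hd : PerfectlyDistinguishable φA φB) :
    (Finset.univ : Finset (KA × KB)).inf' Finset.univ_nonempty
        (fun p => ‖⟪φA p.1, φB p.2⟫_ℂ‖ ^ 2)
      ≤ 1 / ((Fintype.card KA : ℝ) * (Fintype.card KB : ℝ)) := by
  set n : ℝ := (Fintype.card KA : ℝ) * Fintype.card KB with hn
  have hnpos : 0 < n := by positivity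
  obtain ⟨p, -, hp⟩ := Finset.exists_mem_eq_inf' (Finset.univ_nonempty (α := KA × KB))
    (fun p => ‖⟪φA p.1, φB p.2⟫_ℂ‖ ^ 2)
  have hmin : ∀ a b, ‖⟪φA p.1, φB p.2⟫_ℂ‖ ≤ ‖⟪φA a, φB b⟫_ℂ‖ := fun a b => by
    rw [← pow_le_pow_iff_left₀ (norm_nonneg _) (norm_nonneg _) two_ne_zero, ← hp]
    exact Finset.inf'_le (fun p : KA × KB => ‖⟪φA p.1, φB p.2⟫_ℂ‖ ^ 2) (Finset.mem_univ (a, b))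
  have hsum : n * ‖⟪φA p.1, φB p.2⟫_ℂ‖ ≤ ∑ a, ∑ b, ‖⟪φA a, φB b⟫_ℂ‖ := by
    calc n * ‖⟪φA p.1, φB p.2⟫_ℂ‖ = ∑ _a : KA, ∑ _b : KB, ‖⟪φA p.1, φB p.2⟫_ℂ‖ := by
          simp [hn, mul_assoc]
      _ ≤ _ := by
          gcongr with a _ b _
          exact hmin a b
  have hsq : (n * ‖⟪φA p.1, φB p.2⟫_ℂ‖) ^ 2 ≤ n :=
    (pow_le_pow_left₀ (by positivity) hsum 2).trans (hd.sq_sum_norm_inner_le hA.1 hB.1)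
  rw [hp, le_div_iff₀ hnpos]
  refine le_of_mul_le_mul_left ?_ hnpos
  linarith

end
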